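/- Assume α ∈ (0,2], the Hurst functional index H satisfies (H₁) and (H₂), let d ≥ 1 be an integer, let I := [ε,T]^N with 0 < ε < T, and assume d < inf_{v∈I} ∑_{l=1}^N 1/h_l(v). For an integer n ≥ 1 and a cube I_{a,δ} = ∏_{l=1}^N [a_l, a_l + δ] ⊆ I define M_n(I_{a,δ}) := (2π)^{−nd} · ∫_{(I_{a,δ})^n} ( ∫_{ℝ^n} exp(−∫_{ℝ^N} |∑_{j=1}^n x_j · g^{H(u^j)}(u^j, w)|^α dw) dx )^d du^1 … du^n. Then for every integer n ≥ 1 there exist constants c(n) > 0 and δ₀(n) ∈ (0,1] such that for every cube I_{a,δ} ⊆ I with δ ∈ (0, δ₀(n)] and every u* ∈ I_{a,δ}: M_n(I_{a,δ}) ≤ c(n) · (n!)^{N·ν} · δ^{N·n·(1−ν)}, where ν := d / (∑_{l=1}^N 1/h_l(u*)). -/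

import Mathlib

open MeasureTheory Finset
open scoped ENNReal

/-- `(a₊)^c` with the convention `0^c := 0` for every real exponent `c`. -/
noncomputable def ppow (a c : ℝ) : ℝ := if 0 < a then a ^ c else 0

/-- The multifractional kernel `g^{H(u)}(u,w)`. -/
noncomputable def kernelG (N : ℕ) (α : ℝ) (h : Fin N → (Fin N → ℝ) → ℝ)
    (u w : Fin N → ℝ) : ℝ :=
  ∏ l, (ppow (u l - w l) (h l u - 1 / α) - ppow (-w l) (h l u - 1 / α))

/-- The moment quantity
`M_n(C) = (2π)^{-nd} ∫_{C^n} (∫_{ℝ^n} exp(-∫_{ℝ^N} |∑_j x_j g^{H(u^j)}(u^j,w)|^α dw) dx)^d du`. -/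
noncomputable def Mn (N d : ℕ) (α : ℝ) (h : Fin N → (Fin N → ℝ) → ℝ)
    (n : ℕ) (C : Set (Fin N → ℝ)) : ℝ≥0∞ :=
  ENNReal.ofReal ((2 * Real.pi) ^ (-((n : ℝ) * d))) *
    ∫⁻ U : Fin n → Fin N → ℝ in {U | ∀ j, U j ∈ C},
      (∫⁻ x : Fin n → ℝ,
        ENNReal.ofReal (Real.exp (-(∫ w : Fin N → ℝ,
          |∑ j, x j * kernelG N α h (U j) w| ^ α)))) ^ d

/-- Uniform bound for `∫ exp(-φ)` when `φ` grows like `q |t|^α` around every point. -/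
lemma exists_lintegral_exp_neg_le {α : ℝ} (hα : 0 < α) :
    ∃ K : ℝ, 0 < K ∧ ∀ (φ : ℝ → ℝ) (q : ℝ), (∀ t, 0 ≤ φ t) → 0 < q →
      (∀ s t, q * |t - s| ^ α ≤ 2 ^ α * (φ t + φ s)) →
      ∫⁻ t, ENNReal.ofReal (Real.exp (-φ t)) ≤ ENNReal.ofReal (K * q ^ (-1 / α)) := by
  set b : ℝ := 2 ^ α * 2 with hb
  have hb0 : 0 < b := by positivity
  refine ⟨Real.exp 1 * (2 * (b⁻¹ ^ (-1 / α) * Real.Gamma (1 / α + 1))), ?_, ?_⟩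
  · have : 0 < Real.Gamma (1 / α + 1) := Real.Gamma_pos_of_pos (by positivity)
    positivity
  intro φ q hφ hq hgrow
  obtain ⟨s, hs⟩ : ∃ s, ∀ t, φ s ≤ φ t + 1 := by
    have hbdd : BddBelow (Set.range φ) := ⟨0, by rintro _ ⟨t, rfl⟩; exact hφ t⟩
    obtain ⟨s, hs⟩ := exists_lt_of_ciInf_lt (show (⨅ t, φ t) < (⨅ t, φ t) + 1 by linarith)
    exact ⟨s, fun t => hs.le.trans (by linarith [ciInf_le hbdd t])⟩
  have hqb : 0 < q / b := by positivity
  have hpt : ∀ t, Real.exp (-φ t) ≤ Real.exp 1 * Real.exp (-(q / b) * |t - s| ^ α) := by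
    intro t
    rw [← Real.exp_add, Real.exp_le_exp]
    have h1 : q * |t - s| ^ α ≤ b * (φ t + 1) := by
      refine (hgrow s t).trans ?_
      have : (2 : ℝ) ^ α * (φ t + φ s) ≤ 2 ^ α * (2 * φ t + 1) := by
        exact mul_le_mul_of_nonneg_left (by linarith [hs t]) (by positivity)
      have h2 : (0 : ℝ) < 2 ^ α := by positivity
      rw [hb]
      nlinarith
    have h3 : q / b * |t - s| ^ α ≤ φ t + 1 := by
      rw [div_mul_eq_mul_div, div_le_iff₀ hb0]
      linarith
    linarith
  have hval : ∫ x : ℝ, Real.exp (-(q / b) * |x| ^ α)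
      = 2 * ((q / b) ^ (-1 / α) * Real.Gamma (1 / α + 1)) := by
    have := integral_comp_abs (f := fun x : ℝ => Real.exp (-(q / b) * x ^ α))
    rw [this, integral_exp_neg_mul_rpow hα hqb]
  have hint1 : Integrable (fun x : ℝ => Real.exp (-(q / b) * |x| ^ α)) := by
    refine Integrable.of_integral_ne_zero ?_
    rw [hval]
    have : 0 < Real.Gamma (1 / α + 1) := Real.Gamma_pos_of_pos (by positivity)
    positivity
  calc ∫⁻ t, ENNReal.ofReal (Real.exp (-φ t))
      ≤ ∫⁻ t, ENNReal.ofReal (Real.exp 1 * Real.exp (-(q / b) * |t - s| ^ α)) :=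
        lintegral_mono fun t => ENNReal.ofReal_le_ofReal (hpt t)
    _ = ∫⁻ t, ENNReal.ofReal (Real.exp 1 * Real.exp (-(q / b) * |t| ^ α)) :=
        lintegral_sub_right_eq_self
          (fun t => ENNReal.ofReal (Real.exp 1 * Real.exp (-(q / b) * |t| ^ α))) s
    _ = ENNReal.ofReal (∫ t : ℝ, Real.exp 1 * Real.exp (-(q / b) * |t| ^ α)) :=
        (ofReal_integral_eq_lintegral_ofReal (hint1.const_mul _)
          (Filter.Eventually.of_forall fun t => by positivity)).symm
    _ = _ := by
        rw [integral_const_mul, hval, div_eq_mul_inv, Real.mul_rpow hq.le (by positivity)]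
        congr 1
        ring

lemma measurable_finCons {E : Type*} [MeasurableSpace E] (n : ℕ) :
    Measurable fun p : E × (Fin n → E) => (Fin.cons p.1 p.2 : Fin (n + 1) → E) := by
  refine measurable_pi_lambda _ fun i => ?_
  refine Fin.cases ?_ (fun j => ?_) i
  · exact measurable_fst
  · exact (measurable_pi_apply j).comp measurable_snd

/-- Tonelli for the splitting of the first coordinate of a finite product. -/
lemma lintegral_finCons {E : Type*} [MeasurableSpace E] {n : ℕ} (μ : Fin (n + 1) → Measure E)
    [∀ i, SigmaFinite (μ i)] {f : (Fin (n + 1) → E) → ℝ≥0∞} (hf : Measurable f) :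
    ∫⁻ x, f x ∂Measure.pi μ =
      ∫⁻ p : E × (Fin n → E), f (Fin.cons p.1 p.2) ∂(μ 0).prod (Measure.pi fun i => μ i.succ) := by
  have h := (measurePreserving_piFinSuccAbove μ 0).symm
  rw [← h.lintegral_comp hf]
  simp [MeasurableEquiv.piFinSuccAbove, Fin.insertNthEquiv]

lemma lintegral_prod_pi {E : Type*} [MeasurableSpace E] {N : ℕ} (μ : Fin N → Measure E)
    [∀ i, SigmaFinite (μ i)] {f : Fin N → E → ℝ≥0∞} (hf : ∀ i, Measurable (f i)) :
    ∫⁻ x, ∏ i, f i (x i) ∂Measure.pi μ = ∏ i, ∫⁻ t, f i t ∂μ i := by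
  induction N with
  | zero => simp
  | succ N ih =>
    rw [lintegral_finCons μ (by fun_prop)]
    simp only [Fin.prod_univ_succ, Fin.cons_zero, Fin.cons_succ]
    rw [lintegral_prod_mul (g := fun y : Fin N → E => ∏ i, f i.succ (y i))
      (hf 0).aemeasurable
      (Finset.measurable_prod _ fun i _ => (hf i.succ).comp (measurable_pi_apply i)).aemeasurable]
    rw [ih (fun i => μ i.succ) fun i => hf i.succ]

/-- Exchanging the two indices of a matrix preserves Lebesgue measure. -/
lemma measurePreserving_swap_matrix (n N : ℕ) :
    MeasurePreserving (fun (V : Fin N → Fin n → ℝ) (j : Fin n) (l : Fin N) => V l j) := by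
  refine ⟨by fun_prop, ?_⟩
  symm
  refine Measure.pi_eq_generateFrom
    (C := fun _ => Set.pi Set.univ '' Set.pi Set.univ fun _ : Fin N => {s : Set ℝ | MeasurableSet s})
    (fun _ => generateFrom_pi) (fun _ => isPiSystem_pi)
    (fun _ => Measure.FiniteSpanningSetsIn.pi fun _ => Measure.toFiniteSpanningSetsIn volume) ?_
  intro s hs
  choose t ht hts using hs
  rw [Measure.map_apply (by fun_prop)
    (MeasurableSet.univ_pi fun j => by
      rw [← hts j]; exact MeasurableSet.univ_pi fun l => ht j l (Set.mem_univ l))]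
  have : (fun (V : Fin N → Fin n → ℝ) (j : Fin n) (l : Fin N) => V l j) ⁻¹' Set.univ.pi s
      = Set.univ.pi fun l => Set.univ.pi fun j => t j l := by
    ext V
    simp only [Set.mem_preimage, Set.mem_univ_pi, ← hts]
    exact forall_comm
  rw [this, volume_pi_pi]
  simp only [← hts, volume_pi_pi]
  rw [Finset.prod_comm]
  exact Finset.prod_congr rfl fun j _ => (Measure.pi_pi _ _).symm

lemma abs_add_rpow_le {α : ℝ} (hα : 0 < α) (a b : ℝ) :
    |a + b| ^ α ≤ 2 ^ α * (|a| ^ α + |b| ^ α) := by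
  have h1 : |a + b| ≤ 2 * max |a| |b| := by
    have := abs_add_le a b
    have := le_max_left |a| |b|
    have := le_max_right |a| |b|
    linarith
  have h2 : (0 : ℝ) ≤ max |a| |b| := le_max_of_le_left (abs_nonneg a)
  calc |a + b| ^ α ≤ (2 * max |a| |b|) ^ α := Real.rpow_le_rpow (abs_nonneg _) h1 hα.le
    _ = 2 ^ α * (max |a| |b|) ^ α := Real.mul_rpow (by norm_num) h2
    _ ≤ _ := by
      refine mul_le_mul_of_nonneg_left ?_ (by positivity)
      rcases max_choice |a| |b| with h | h <;> rw [h]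
      · exact le_add_of_nonneg_right (by positivity)
      · exact le_add_of_nonneg_left (by positivity)

lemma integrable_abs_sum_rpow {W : Type*} [MeasurableSpace W] {ν : Measure W} {α : ℝ} (hα : 0 < α)
    {n : ℕ} {G : Fin n → W → ℝ} (hG : ∀ j, Measurable (G j))
    (hint : ∀ j, Integrable (fun w => |G j w| ^ α) ν) (x : Fin n → ℝ) :
    Integrable (fun w => |∑ j, x j * G j w| ^ α) ν := by
  have hp : ENNReal.ofReal α ≠ 0 := by simpa using hα
  have key : ∀ {f : W → ℝ}, Measurable f →
      (Integrable (fun w => |f w| ^ α) ν ↔ MemLp f (ENNReal.ofReal α) ν) := by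
    intro f hf
    rw [← integrable_norm_rpow_iff hf.aestronglyMeasurable hp ENNReal.ofReal_ne_top,
      ENNReal.toReal_ofReal hα.le]
    simp only [Real.norm_eq_abs]
  rw [key (by fun_prop)]
  exact memLp_finsetSum _ fun j _ => ((key (hG j)).1 (hint j)).const_mul (x j)

/-- If the functions `G j` are triangular with respect to disjoint regions `S k`, then the
integral of `exp (-∑ k, ∫_{S k} |∑ j, x j * G j| ^ α)` factorises into one-dimensional bounds. -/
lemma lintegral_exp_neg_triangular_le {α K : ℝ} (hα : 0 < α) (hK0 : 0 < K)
    (hK : ∀ (φ : ℝ → ℝ) (q : ℝ), (∀ t, 0 ≤ φ t) → 0 < q →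
      (∀ s t, q * |t - s| ^ α ≤ 2 ^ α * (φ t + φ s)) →
      ∫⁻ t, ENNReal.ofReal (Real.exp (-φ t)) ≤ ENNReal.ofReal (K * q ^ (-1 / α)))
    {W : Type*} [MeasurableSpace W] {ν : Measure W} [SFinite ν] {n : ℕ}
    {G : Fin n → W → ℝ} (hG : ∀ j, Measurable (G j))
    (hint : ∀ j, Integrable (fun w => |G j w| ^ α) ν)
    {S : Fin n → Set W} (hS : ∀ k, MeasurableSet (S k))
    (hzero : ∀ j k, j < k → ∀ w ∈ S k, G j w = 0)
    {q : Fin n → ℝ} (hq : ∀ k, 0 < q k) (hqG : ∀ k, q k ≤ ∫ w in S k, |G k w| ^ α ∂ν) :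
    ∫⁻ x : Fin n → ℝ, ENNReal.ofReal
        (Real.exp (-∑ k, ∫ w in S k, |∑ j, x j * G j w| ^ α ∂ν))
      ≤ ENNReal.ofReal (∏ k, (K * q k ^ (-1 / α))) := by
  induction n with
  | zero => simp [volume_pi]
  | succ n ih =>
    have hmeas : ∀ k, Measurable
        fun x : Fin (n + 1) → ℝ => ∫ w in S k, |∑ j, x j * G j w| ^ α ∂ν := by
      intro k
      refine (StronglyMeasurable.integral_prod_right (ν := ν.restrict (S k))
        (f := fun (x : Fin (n + 1) → ℝ) w => |∑ j, x j * G j w| ^ α) ?_).measurable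
      refine Measurable.stronglyMeasurable ?_
      have : ∀ j, Measurable fun p : (Fin (n + 1) → ℝ) × W => G j p.2 :=
        fun j => (hG j).comp measurable_snd
      unfold Function.uncurry
      fun_prop
    rw [volume_pi, lintegral_finCons _ (by fun_prop), lintegral_prod_symm' _ ?_]
    swap
    · exact Measurable.comp (g := fun x : Fin (n + 1) → ℝ => ENNReal.ofReal
        (Real.exp (-∑ k, ∫ w in S k, |∑ j, x j * G j w| ^ α ∂ν))) (by fun_prop)
        (measurable_finCons n)
    have hsucc : ∀ (k : Fin n) (t : ℝ) (y : Fin n → ℝ),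
        ∫ w in S k.succ, |∑ j, (Fin.cons t y : Fin (n + 1) → ℝ) j * G j w| ^ α ∂ν
          = ∫ w in S k.succ, |∑ j, y j * G j.succ w| ^ α ∂ν := by
      intro k t y
      refine setIntegral_congr_fun (hS _) fun w hw => ?_
      simp [Fin.sum_univ_succ, hzero 0 k.succ (Fin.succ_pos k) w hw]
    have hinner : ∀ y : Fin n → ℝ,
        ∫⁻ t : ℝ, ENNReal.ofReal (Real.exp (-∑ k, ∫ w in S k,
            |∑ j, (Fin.cons t y : Fin (n + 1) → ℝ) j * G j w| ^ α ∂ν))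
          ≤ ENNReal.ofReal (K * q 0 ^ (-1 / α)) * ENNReal.ofReal
            (Real.exp (-∑ k : Fin n, ∫ w in S k.succ, |∑ j, y j * G j.succ w| ^ α ∂ν)) := by
      intro y
      set φ : ℝ → ℝ := fun t => ∫ w in S 0,
        |∑ j, (Fin.cons t y : Fin (n + 1) → ℝ) j * G j w| ^ α ∂ν with hφ
      have hφK := hK φ (q 0) (fun t => integral_nonneg fun w => by positivity) (hq 0) ?_
      · calc _ = ∫⁻ t : ℝ, ENNReal.ofReal (Real.exp (-φ t)) * ENNReal.ofReal
              (Real.exp (-∑ k : Fin n, ∫ w in S k.succ, |∑ j, y j * G j.succ w| ^ α ∂ν)) := by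
              refine lintegral_congr fun t => ?_
              rw [← ENNReal.ofReal_mul (Real.exp_pos _).le, ← Real.exp_add, Fin.sum_univ_succ]
              simp only [hsucc, hφ]
              congr 2
              ring
          _ = (∫⁻ t : ℝ, ENNReal.ofReal (Real.exp (-φ t))) * ENNReal.ofReal
              (Real.exp (-∑ k : Fin n, ∫ w in S k.succ, |∑ j, y j * G j.succ w| ^ α ∂ν)) :=
              lintegral_mul_const' _ _ ENNReal.ofReal_ne_top
          _ ≤ _ := by gcongr
      · intro s t
        have hi : ∀ r : ℝ, Integrable (fun w =>
            |∑ j, (Fin.cons r y : Fin (n + 1) → ℝ) j * G j w| ^ α) (ν.restrict (S 0)) :=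
          fun r => integrable_abs_sum_rpow hα hG (fun j => (hint j).integrableOn) _
        have h1 : ∀ w, |t - s| ^ α * |G 0 w| ^ α ≤ 2 ^ α *
            (|∑ j, (Fin.cons t y : Fin (n + 1) → ℝ) j * G j w| ^ α
              + |∑ j, (Fin.cons s y : Fin (n + 1) → ℝ) j * G j w| ^ α) := by
          intro w
          have := abs_add_rpow_le hα (∑ j, (Fin.cons t y : Fin (n + 1) → ℝ) j * G j w)
            (-∑ j, (Fin.cons s y : Fin (n + 1) → ℝ) j * G j w)
          rw [abs_neg] at this
          refine le_trans (le_of_eq ?_) this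
          rw [← Real.mul_rpow (abs_nonneg _) (abs_nonneg _), ← abs_mul]
          simp only [Fin.sum_univ_succ, Fin.cons_zero, Fin.cons_succ]
          congr 2
          ring
        calc q 0 * |t - s| ^ α ≤ (∫ w in S 0, |G 0 w| ^ α ∂ν) * |t - s| ^ α := by
              gcongr
              exact hqG 0
          _ = ∫ w in S 0, |t - s| ^ α * |G 0 w| ^ α ∂ν := by
              rw [integral_const_mul, mul_comm]
          _ ≤ ∫ w in S 0, 2 ^ α *
            (|∑ j, (Fin.cons t y : Fin (n + 1) → ℝ) j * G j w| ^ α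
              + |∑ j, (Fin.cons s y : Fin (n + 1) → ℝ) j * G j w| ^ α) ∂ν :=
              integral_mono (((hint 0).integrableOn).const_mul _)
                (((hi t).add (hi s)).const_mul _) h1
          _ = _ := by rw [integral_const_mul, integral_add (hi t) (hi s)]
    refine (lintegral_mono hinner).trans ?_
    rw [lintegral_const_mul' _ _ ENNReal.ofReal_ne_top, Fin.prod_univ_succ,
      ENNReal.ofReal_mul (mul_nonneg hK0.le (Real.rpow_nonneg (hq 0).le _))]
    gcongr
    exact ih (fun j => hG j.succ) (fun j => hint j.succ) (fun k => hS k.succ)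
      (fun j k hjk w hw => hzero j.succ k.succ (Fin.succ_lt_succ_iff.2 hjk) w hw)
      (fun k => hq k.succ) (fun k => hqG k.succ)

lemma measurable_ppow (c : ℝ) : Measurable fun a => ppow a c := by
  unfold ppow
  exact Measurable.ite measurableSet_Ioi (by fun_prop) measurable_const

lemma ppow_nonneg (a c : ℝ) : 0 ≤ ppow a c := by
  unfold ppow
  split_ifs with h
  · positivity
  · exact le_rfl

lemma abs_ppow_rpow {α : ℝ} (hα : 0 < α) (a c : ℝ) : |ppow a c| ^ α = ppow a (c * α) := by
  rw [abs_of_nonneg (ppow_nonneg a c)]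
  unfold ppow
  split_ifs with h
  · rw [Real.rpow_mul h.le]
  · exact Real.zero_rpow hα.ne'

lemma intervalIntegrable_ppow {c : ℝ} (hc : -1 < c) (a b : ℝ) :
    IntervalIntegrable (fun x => ppow x c) volume a b := by
  have h := intervalIntegral.intervalIntegrable_rpow' hc (a := a) (b := b)
  have hind : (fun x => ppow x c) = (Set.Ioi (0 : ℝ)).indicator fun x => x ^ c := by
    ext x
    simp [ppow, Set.indicator_apply]
  rw [intervalIntegrable_iff] at h ⊢
  rw [hind]
  exact h.indicator measurableSet_Ioi

/-- The one-dimensional factor of the kernel lies in `L^α`. -/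
lemma integrable_ppow_sub_ppow {α H u : ℝ} (hα : 0 < α) (hH0 : 0 < H) (hH1 : H < 1) (hu : 0 < u) :
    Integrable fun w => |ppow (u - w) (H - 1 / α) - ppow (-w) (H - 1 / α)| ^ α := by
  set e := H - 1 / α with he
  have heα : e * α = H * α - 1 := by rw [he]; field_simp
  have he1 : e < 1 := by
    have : 0 < 1 / α := by positivity
    linarith
  suffices h : Integrable fun x => |ppow (u + x) e - ppow x e| ^ α by
    have := h.comp_neg
    simpa only [← sub_eq_add_neg] using this
  have hmeas : Measurable fun x => |ppow (u + x) e - ppow x e| ^ α := by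
    have := measurable_ppow e
    fun_prop
  have hlow : IntegrableOn (fun x => |ppow (u + x) e - ppow x e| ^ α) (Set.Iic (-u)) := by
    refine integrableOn_zero.congr_fun (fun x hx => ?_) measurableSet_Iic
    have hx : x ≤ -u := hx
    simp [ppow, show ¬ 0 < u + x by linarith, show ¬ 0 < x by linarith, Real.zero_rpow hα.ne']
  have hmid : IntegrableOn (fun x => |ppow (u + x) e - ppow x e| ^ α) (Set.Ioc (-u) u) := by
    have h1 := intervalIntegrable_ppow (c := e * α) (by rw [heα]; nlinarith) (-u) u
    have h2 := (intervalIntegrable_ppow (c := e * α) (by rw [heα]; nlinarith) 0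
      (u + u)).comp_add_left u
    rw [zero_sub, add_sub_cancel_right] at h2
    have h3 := (h2.add h1).const_mul (2 ^ α)
    rw [intervalIntegrable_iff_integrableOn_Ioc_of_le (by linarith)] at h3
    refine h3.mono' hmeas.aestronglyMeasurable (Filter.Eventually.of_forall fun x => ?_)
    rw [Real.norm_of_nonneg (by positivity)]
    have := abs_add_rpow_le hα (ppow (u + x) e) (-ppow x e)
    rw [abs_neg, ← sub_eq_add_neg] at this
    simpa only [abs_ppow_rpow hα] using this
  have hhigh : IntegrableOn (fun x => |ppow (u + x) e - ppow x e| ^ α) (Set.Ioi u) := by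
    have h1 := (integrableOn_Ioi_rpow_of_lt (a := (e - 1) * α) (by nlinarith) hu).const_mul
      ((|e| * u) ^ α)
    refine h1.mono' hmeas.aestronglyMeasurable ?_
    refine (ae_restrict_iff' measurableSet_Ioi).2 (Filter.Eventually.of_forall fun x hx => ?_)
    have hx0 : 0 < x := hu.trans hx
    rw [Real.norm_of_nonneg (by positivity), Real.rpow_mul hx0.le, ← Real.mul_rpow (by positivity)
      (by positivity)]
    refine Real.rpow_le_rpow (abs_nonneg _) ?_ hα.le
    have hd : ∀ y ∈ Set.Icc x (u + x), HasDerivWithinAt (fun y : ℝ => y ^ e) (e * y ^ (e - 1))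
        (Set.Icc x (u + x)) y := fun y hy =>
      (Real.hasDerivAt_rpow_const (Or.inl (hx0.trans_le hy.1).ne')).hasDerivWithinAt
    have hb : ∀ y ∈ Set.Icc x (u + x), ‖e * y ^ (e - 1)‖ ≤ |e| * x ^ (e - 1) := by
      intro y hy
      have hy0 := hx0.trans_le hy.1
      rw [norm_mul, Real.norm_eq_abs, Real.norm_of_nonneg (by positivity)]
      exact mul_le_mul_of_nonneg_left
        (Real.rpow_le_rpow_of_nonpos hx0 hy.1 (by linarith)) (abs_nonneg _)
    have := (convex_Icc x (u + x)).norm_image_sub_le_of_norm_hasDerivWithin_le hd hb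
      (Set.left_mem_Icc.2 (by linarith)) (Set.right_mem_Icc.2 (by linarith))
    simp only [ppow, show 0 < u + x by linarith, hx0, if_true]
    rw [Real.norm_eq_abs, Real.norm_eq_abs, add_sub_cancel_right, abs_of_pos hu] at this
    linarith
  rw [← integrableOn_univ, ← Set.Iic_union_Ioi (a := u),
    ← Set.Iic_union_Ioc_eq_Iic (show -u ≤ u by linarith)]
  exact (hlow.union hmid).union hhigh

lemma measurable_kernelG (N : ℕ) (α : ℝ) (h : Fin N → (Fin N → ℝ) → ℝ) (u : Fin N → ℝ) :
    Measurable (kernelG N α h u) := by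
  unfold kernelG
  have := measurable_ppow
  fun_prop

lemma integrable_kernelG {N : ℕ} {α : ℝ} {h : Fin N → (Fin N → ℝ) → ℝ} {u : Fin N → ℝ}
    (hα : 0 < α) (hH0 : ∀ l, 0 < h l u) (hH1 : ∀ l, h l u < 1) (hu : ∀ l, 0 < u l) :
    Integrable fun w => |kernelG N α h u w| ^ α := by
  have := Integrable.fintype_prod (𝕜 := ℝ) (μ := fun _ : Fin N => volume)
    fun l => integrable_ppow_sub_ppow (u := u l) hα (hH0 l) (hH1 l) (hu l)
  refine this.congr (Filter.Eventually.of_forall fun w => ?_)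
  simp only [kernelG]
  rw [Finset.abs_prod, Real.finsetProd_rpow _ _ fun _ _ => abs_nonneg _]

/-- The box on which the `l₀`-th coordinate runs through the first half of the interval `(p, q)`
while the other coordinates run through `(0, ε / 2)`. -/
def stripBox {N : ℕ} (ε : ℝ) (l₀ : Fin N) (p q : ℝ) : Set (Fin N → ℝ) :=
  Set.univ.pi fun l => if l = l₀ then Set.Ioo p ((p + q) / 2) else Set.Ioo 0 (ε / 2)

lemma measurableSet_stripBox {N : ℕ} (ε : ℝ) (l₀ : Fin N) (p q : ℝ) :
    MeasurableSet (stripBox ε l₀ p q) :=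
  MeasurableSet.univ_pi fun l => by split_ifs <;> exact measurableSet_Ioo

lemma mem_Ioo_of_mem_stripBox {N : ℕ} {ε : ℝ} {l₀ : Fin N} {p q : ℝ} {w : Fin N → ℝ}
    (hw : w ∈ stripBox ε l₀ p q) : w l₀ ∈ Set.Ioo p ((p + q) / 2) := by
  simpa using hw l₀ (Set.mem_univ _)

lemma integral_stripBox_kernelG_ge {N : ℕ} {α : ℝ} {h : Fin N → (Fin N → ℝ) → ℝ} {u : Fin N → ℝ}
    (hα : 0 < α) (hα2 : α ≤ 2) (hH0 : ∀ l, 0 < h l u) (hH1 : ∀ l, h l u < 1)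
    {ε T : ℝ} (hε : 0 < ε) (hu : ∀ l, ε ≤ u l) (huT : ∀ l, u l ≤ T) (l₀ : Fin N) {p : ℝ}
    (hp : ε ≤ p) (hpu : p < u l₀) :
    (1 / 4) * (min (ε / 2) T⁻¹ * (ε / 2)) ^ (N - 1) * (u l₀ - p) ^ (α * h l₀ u)
      ≤ ∫ w in stripBox ε l₀ p (u l₀), |kernelG N α h u w| ^ α := by
  have hT : 0 < T := hε.trans_le ((hu l₀).trans (huT l₀))
  set f : Fin N → ℝ → ℝ :=
    fun l x => |ppow (u l - x) (h l u - 1 / α) - ppow (-x) (h l u - 1 / α)| ^ α with hf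
  have hfi : ∀ l, Integrable (f l) := fun l =>
    integrable_ppow_sub_ppow (u := u l) hα (hH0 l) (hH1 l) (hε.trans_le (hu l))
  have hfval : ∀ l x, 0 < x → x < u l → f l x = (u l - x) ^ (α * h l u - 1) := by
    intro l x hx0 hxu
    have : ppow (-x) (h l u - 1 / α) = 0 := by simp [ppow, hx0.le]
    simp only [hf, this, sub_zero, abs_ppow_rpow hα]
    rw [ppow, if_pos (by linarith)]
    congr 1
    field_simp
  have hr1 : ∀ l, α * h l u - 1 ≤ 1 := fun l => by nlinarith [hH0 l, hH1 l]
  have hrm : ∀ l, -1 ≤ α * h l u - 1 := fun l => by nlinarith [hH0 l, hH1 l]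
  have hprod : ∫ w in stripBox ε l₀ p (u l₀), |kernelG N α h u w| ^ α
      = ∏ l, ∫ x in (if l = l₀ then Set.Ioo p ((p + u l₀) / 2) else Set.Ioo 0 (ε / 2)), f l x := by
    rw [← integral_fintype_prod_eq_prod (𝕜 := ℝ), stripBox, volume_pi, Measure.restrict_pi_pi]
    refine integral_congr_ae (Filter.Eventually.of_forall fun w => ?_)
    simp only [kernelG, hf]
    rw [Finset.abs_prod, Real.finsetProd_rpow _ _ fun _ _ => abs_nonneg _]
  have hside : ∀ l, min (ε / 2) T⁻¹ * (ε / 2) ≤ ∫ x in Set.Ioo 0 (ε / 2), f l x := by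
    intro l
    have := setIntegral_ge_of_const_le_real (f := f l) (μ := volume) (s := Set.Ioo 0 (ε / 2))
      (c := min (ε / 2) T⁻¹) measurableSet_Ioo (by simp) (fun x hx => ?_) (hfi l).integrableOn
    · rwa [Real.volume_real_Ioo_of_le (by positivity), sub_zero] at this
    · have hux := hu l
      have hx1 : ε / 2 ≤ u l - x := by linarith [hx.2]
      have hx0 : 0 < u l - x := by linarith
      rw [hfval l x hx.1 (by linarith)]
      rcases le_total (u l - x) 1 with h1 | h1
      · calc _ ≤ ε / 2 := min_le_left _ _
          _ ≤ (u l - x) ^ (1 : ℝ) := by rwa [Real.rpow_one]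
          _ ≤ _ := Real.rpow_le_rpow_of_exponent_ge hx0 h1 (hr1 l)
      · calc _ ≤ T⁻¹ := min_le_right _ _
          _ ≤ (u l - x)⁻¹ := inv_anti₀ hx0 (by linarith [huT l, hx.1])
          _ = (u l - x) ^ (-1 : ℝ) := (Real.rpow_neg_one _).symm
          _ ≤ _ := Real.rpow_le_rpow_of_exponent_le h1 (hrm l)
  have hmain : (1 / 4) * (u l₀ - p) ^ (α * h l₀ u)
      ≤ ∫ x in Set.Ioo p ((p + u l₀) / 2), f l₀ x := by
    set g := u l₀ - p with hg
    have hg0 : 0 < g := by linarith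
    have := setIntegral_ge_of_const_le_real (f := f l₀) (μ := volume)
      (s := Set.Ioo p ((p + u l₀) / 2)) (c := g ^ (α * h l₀ u - 1) * (1 / 2)) measurableSet_Ioo
      (by simp) (fun x hx => ?_) (hfi l₀).integrableOn
    · refine le_trans (le_of_eq ?_) this
      have hv : volume.real (Set.Ioo p ((p + u l₀) / 2)) = g / 2 := by
        rw [Real.volume_real_Ioo_of_le (by linarith)]
        ring
      rw [hv, Real.rpow_sub_one hg0.ne']
      field_simp
      norm_num
    · have hx1 := hx.1
      have hx2 := hx.2
      have hx0 : 0 < u l₀ - x := by linarith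
      rw [hfval l₀ x (by linarith) (by linarith)]
      have hq0 : 0 < (u l₀ - x) / g := by positivity
      have hsplit : u l₀ - x = g * ((u l₀ - x) / g) := by field_simp
      rw [hsplit, Real.mul_rpow hg0.le hq0.le]
      refine mul_le_mul_of_nonneg_left ?_ (by positivity)
      calc (1 / 2 : ℝ) ≤ (u l₀ - x) / g := by
            rw [le_div_iff₀ hg0]
            linarith
        _ = ((u l₀ - x) / g) ^ (1 : ℝ) := (Real.rpow_one _).symm
        _ ≤ _ := Real.rpow_le_rpow_of_exponent_ge hq0
          (by rw [div_le_one hg0]; linarith) (hr1 l₀)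
  have hκ : 0 ≤ min (ε / 2) T⁻¹ * (ε / 2) := by positivity
  rw [hprod, ← Finset.mul_prod_erase _ _ (Finset.mem_univ l₀), if_pos rfl]
  calc _ = (1 / 4) * (u l₀ - p) ^ (α * h l₀ u)
        * ∏ l ∈ Finset.univ.erase l₀, (min (ε / 2) T⁻¹ * (ε / 2)) := by
        rw [Finset.prod_const, Finset.card_erase_of_mem (Finset.mem_univ _), Finset.card_univ,
          Fintype.card_fin]
        ring
    _ ≤ _ := by
        have hge : (0 : ℝ) ≤ (u l₀ - p) ^ (α * h l₀ u) := Real.rpow_nonneg (by linarith) _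
        refine mul_le_mul hmain (Finset.prod_le_prod (fun _ _ => hκ) fun l hl => ?_)
          (Finset.prod_nonneg fun _ _ => hκ) ((by positivity : (0 : ℝ) ≤ _).trans hmain)
        rw [if_neg (Finset.ne_of_mem_erase hl)]
        exact hside l

lemma ennreal_prod_eq_top {ι : Type*} {s : Finset ι} {f : ι → ℝ≥0∞} {i : ι} (hi : i ∈ s)
    (htop : f i = ⊤) (h0 : ∀ j ∈ s, f j ≠ 0) : ∏ j ∈ s, f j = ⊤ := by
  classical
  rw [← Finset.mul_prod_erase _ _ hi, htop, ENNReal.top_mul]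
  exact Finset.prod_ne_zero_iff.2 fun j hj => h0 j (Finset.mem_of_mem_erase hj)

/-- Bound for the inner integral of `Mn` coming from one coordinate direction, in terms of the gaps
between the ordered coordinates in that direction. -/
lemma lintegral_exp_neg_kernelG_le {N : ℕ} {α K : ℝ} {h : Fin N → (Fin N → ℝ) → ℝ}
    (hα : 0 < α) (hα2 : α ≤ 2) (hK0 : 0 < K)
    (hK : ∀ (φ : ℝ → ℝ) (q : ℝ), (∀ t, 0 ≤ φ t) → 0 < q →
      (∀ s t, q * |t - s| ^ α ≤ 2 ^ α * (φ t + φ s)) →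
      ∫⁻ t, ENNReal.ofReal (Real.exp (-φ t)) ≤ ENNReal.ofReal (K * q ^ (-1 / α)))
    (hH0 : ∀ l u, 0 < h l u) (hH1 : ∀ l u, h l u < 1) {ε T : ℝ} (hε : 0 < ε) (hεT : ε < T)
    {n : ℕ} {U : Fin n → Fin N → ℝ} (hU : ∀ j l, ε ≤ U j l) (hUT : ∀ j l, U j l ≤ T)
    (l₀ : Fin N) {a : ℝ} (haε : ε ≤ a) (ha : ∀ j, a ≤ U j l₀) (σ : Equiv.Perm (Fin n))
    (hσ : Monotone fun k => U (σ k) l₀) :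
    ∫⁻ x : Fin n → ℝ, ENNReal.ofReal
        (Real.exp (-(∫ w : Fin N → ℝ, |∑ j, x j * kernelG N α h (U j) w| ^ α)))
      ≤ ∏ k, (ENNReal.ofReal
          (K * ((1 / 4) * (min (ε / 2) T⁻¹ * (ε / 2)) ^ (N - 1)) ^ (-1 / α)) *
        ENNReal.ofReal (U (σ k) l₀ - (Fin.cons a fun k => U (σ k) l₀ : Fin (n + 1) → ℝ) k.castSucc)
          ^ (-h l₀ (U (σ k)))) := by
  set κ : ℝ := (1 / 4) * (min (ε / 2) T⁻¹ * (ε / 2)) ^ (N - 1) with hκ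
  have hT : 0 < T := hε.trans hεT
  have hκ0 : 0 < κ := by positivity
  set y : Fin n → ℝ := fun k => U (σ k) l₀ with hy
  set z : Fin (n + 1) → ℝ := Fin.cons a y with hz
  have hC0 : 0 < K * κ ^ (-1 / α) := by positivity
  by_cases hpos : ∀ k : Fin n, z k.castSucc < y k
  swap
  · push Not at hpos
    obtain ⟨k, hk⟩ := hpos
    refine le_top.trans (ennreal_prod_eq_top (Finset.mem_univ k) ?_ fun j _ => ?_).ge
    · rw [ENNReal.ofReal_of_nonpos (sub_nonpos.2 hk), ENNReal.zero_rpow_of_neg (by linarith [hH0 l₀ (U (σ k))]),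
        ENNReal.mul_top]
      simpa using hC0
    · refine mul_ne_zero (by simpa using hC0) ?_
      rw [ENNReal.rpow_neg]
      simp [ENNReal.rpow_eq_top_iff, hH0, (hH0 l₀ (U (σ j))).not_gt]
  have hzlt : ∀ j k : Fin n, j < k → y j ≤ z k.castSucc := by
    intro j k hjk
    obtain ⟨n, rfl⟩ : ∃ m, n = m + 1 := ⟨n - 1, by have := k.pos; omega⟩
    obtain ⟨k', rfl⟩ := Fin.exists_succ_eq.2 (Fin.ne_zero_of_lt hjk)
    rw [← Fin.succ_castSucc, hz, Fin.cons_succ]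
    exact hσ (Fin.le_castSucc_iff.2 hjk)
  have hza : ∀ k : Fin n, ε ≤ z k.castSucc := by
    intro k
    obtain ⟨n, rfl⟩ : ∃ m, n = m + 1 := ⟨n - 1, by have := k.pos; omega⟩
    refine Fin.cases ?_ (fun k' => ?_) k
    · simpa [hz] using haε
    · rw [← Fin.succ_castSucc, hz, Fin.cons_succ]
      exact hU _ _
  set G : Fin n → (Fin N → ℝ) → ℝ := fun k => kernelG N α h (U (σ k)) with hG
  set S : Fin n → Set (Fin N → ℝ) := fun k => stripBox ε l₀ (z k.castSucc) (y k) with hS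
  have hGm : ∀ k, Measurable (G k) := fun k => measurable_kernelG _ _ _ _
  have hGi : ∀ k, Integrable fun w => |G k w| ^ α := fun k =>
    integrable_kernelG hα (fun l => hH0 l _) (fun l => hH1 l _) fun l => hε.trans_le (hU _ l)
  have hSm : ∀ k, MeasurableSet (S k) := fun k => measurableSet_stripBox _ _ _ _
  have hzero : ∀ j k, j < k → ∀ w ∈ S k, G j w = 0 := by
    intro j k hjk w hw
    have h1 := (mem_Ioo_of_mem_stripBox hw).1
    have h2 := hzlt j k hjk
    have h3 := hza k
    refine Finset.prod_eq_zero (Finset.mem_univ l₀) ?_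
    have h4 : ¬ 0 < U (σ j) l₀ - w l₀ := by
      have : y j < w l₀ := h2.trans_lt h1
      simp only [hy] at this
      linarith
    have h5 : ¬ 0 < -w l₀ := by linarith
    simp [ppow, h4, h5]
  have hdisj : Pairwise (Function.onFun Disjoint S) := by
    have key : ∀ j k, j < k → Disjoint (S j) (S k) := by
      intro j k hjk
      refine Set.disjoint_left.2 fun w hj hk => ?_
      have h1 := (mem_Ioo_of_mem_stripBox hj).2
      have h2 := (mem_Ioo_of_mem_stripBox hk).1
      have h3 := hzlt j k hjk
      have h4 := hpos j
      linarith
    intro j k hjk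
    rcases lt_or_gt_of_ne hjk with hlt | hlt
    · exact key j k hlt
    · exact (key k j hlt).symm
  have hq : ∀ k, κ * (y k - z k.castSucc) ^ (α * h l₀ (U (σ k))) ≤ ∫ w in S k, |G k w| ^ α :=
    fun k => integral_stripBox_kernelG_ge hα hα2 (fun l => hH0 l _) (fun l => hH1 l _) hε
      (hU _) (hUT _) l₀ (hza k) (hpos k)
  have hgap : ∀ k, 0 < y k - z k.castSucc := fun k => sub_pos.2 (hpos k)
  have hmain := lintegral_exp_neg_triangular_le hα hK0 hK hGm hGi hSm hzero
    (fun k => mul_pos hκ0 (Real.rpow_pos_of_pos (hgap k) _)) hq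
  calc _ = ∫⁻ x : Fin n → ℝ, ENNReal.ofReal
        (Real.exp (-(∫ w : Fin N → ℝ, |∑ k, x k * G k w| ^ α))) := by
        rw [← (volume_measurePreserving_piCongrLeft (fun _ : Fin n => ℝ) σ).lintegral_comp_emb
          (MeasurableEquiv.measurableEmbedding _)]
        refine lintegral_congr fun x => ?_
        have : ∀ w, ∑ j, (MeasurableEquiv.piCongrLeft (fun _ : Fin n => ℝ) σ) x j *
            kernelG N α h (U j) w = ∑ k, x k * G k w := by
          intro w
          rw [← Equiv.sum_comp σ]
          refine Finset.sum_congr rfl fun k _ => ?_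
          rw [MeasurableEquiv.coe_piCongrLeft, Equiv.piCongrLeft_apply_apply]
        simp only [this]
    _ ≤ ∫⁻ x : Fin n → ℝ, ENNReal.ofReal
        (Real.exp (-∑ k, ∫ w in S k, |∑ j, x j * G j w| ^ α)) := by
        refine lintegral_mono fun x => ENNReal.ofReal_le_ofReal (Real.exp_le_exp.2 (neg_le_neg ?_))
        have hi := integrable_abs_sum_rpow hα hGm hGi x
        rw [← integral_iUnion_fintype hSm hdisj fun k => hi.integrableOn]
        exact setIntegral_le_integral hi (Filter.Eventually.of_forall fun w => by positivity)
    _ ≤ _ := hmain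
    _ = _ := by
        rw [ENNReal.ofReal_prod_of_nonneg fun k _ => ?_]
        · refine Finset.prod_congr rfl fun k _ => ?_
          rw [ENNReal.ofReal_rpow_of_pos (hgap k), ← ENNReal.ofReal_mul hC0.le,
            Real.mul_rpow hκ0.le (Real.rpow_nonneg (hgap k).le _), ← Real.rpow_mul (hgap k).le,
            show α * h l₀ (U (σ k)) * (-1 / α) = -h l₀ (U (σ k)) by field_simp, mul_assoc]
        · have := hgap k
          positivity

lemma lintegral_Icc_abs_sub_rpow_le {p : ℝ} (hp1 : p < 1) {δ : ℝ} (hδ : 0 < δ)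
    {a b : ℝ} (ha : a ∈ Set.Icc b (b + δ)) :
    ∫⁻ t in Set.Icc b (b + δ), ENNReal.ofReal |t - a| ^ (-p)
      ≤ ENNReal.ofReal (2 * (δ ^ (1 - p) / (1 - p))) := by
  set f : ℝ → ℝ := (Set.Iic δ).indicator fun x => x ^ (-p) with hf
  have hval : ∫ x, f |x| = 2 * (δ ^ (1 - p) / (1 - p)) := by
    rw [integral_comp_abs, hf, setIntegral_indicator measurableSet_Iic, Set.Ioi_inter_Iic,
      ← intervalIntegral.integral_of_le hδ.le, integral_rpow (Or.inl (by linarith)),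
      Real.zero_rpow (by linarith)]
    rw [show -p + 1 = 1 - p by ring, sub_zero]
  have hp : 0 < 1 - p := by linarith
  have hint : Integrable fun x => f |x| := by
    refine Integrable.of_integral_ne_zero ?_
    rw [hval]
    positivity
  have hf0 : ∀ x, 0 ≤ f |x| := fun x => by
    simp only [hf, Set.indicator_apply]
    split_ifs <;> positivity
  calc _ ≤ ∫⁻ t in Set.Icc b (b + δ), ENNReal.ofReal (f |t - a|) := by
        refine setLIntegral_mono_ae' measurableSet_Icc ?_
        have : ∀ᵐ t : ℝ, t ≠ a := by simp [ae_iff]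
        filter_upwards [this] with t hta ht
        have h0 : 0 < |t - a| := abs_pos.2 (sub_ne_zero.2 hta)
        have h1 : |t - a| ≤ δ := by
          rw [abs_le]
          constructor <;> linarith [ht.1, ht.2, ha.1, ha.2]
        rw [ENNReal.ofReal_rpow_of_pos h0, hf, Set.indicator_of_mem (by exact h1)]
    _ ≤ ∫⁻ t, ENNReal.ofReal (f |t - a|) := setLIntegral_le_lintegral _ _
    _ = ∫⁻ t, ENNReal.ofReal (f |t|) := lintegral_sub_right_eq_self
          (fun t => ENNReal.ofReal (f |t|)) a
    _ = ENNReal.ofReal (∫ t, f |t|) :=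
        (ofReal_integral_eq_lintegral_ofReal hint (Filter.Eventually.of_forall hf0)).symm
    _ = _ := by rw [hval]

/-- The product of `g` along the chain `a, y 0, y 1, …`. -/
noncomputable def chainProd {n : ℕ} (g : ℝ → ℝ → ℝ≥0∞) (a : ℝ) (y : Fin n → ℝ) : ℝ≥0∞ :=
  ∏ k, g ((Fin.cons a y : Fin (n + 1) → ℝ) k.castSucc) (y k)

lemma chainProd_succ {n : ℕ} (g : ℝ → ℝ → ℝ≥0∞) (a t : ℝ) (y : Fin n → ℝ) :
    chainProd g a (Fin.cons t y : Fin (n + 1) → ℝ) = g a t * chainProd g t y := by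
  simp only [chainProd, Fin.prod_univ_succ, Fin.castSucc_zero, Fin.cons_zero, Fin.cons_succ,
    ← Fin.succ_castSucc]

lemma measurable_chainProd {n : ℕ} {g : ℝ → ℝ → ℝ≥0∞} (hg : Measurable (Function.uncurry g)) :
    Measurable fun p : ℝ × (Fin n → ℝ) => chainProd g p.1 p.2 := by
  refine Finset.measurable_prod _ fun k _ => ?_
  have h1 : Measurable fun p : ℝ × (Fin n → ℝ) =>
      (Fin.cons p.1 p.2 : Fin (n + 1) → ℝ) k.castSucc :=
    measurable_pi_iff.1 (measurable_finCons n) k.castSucc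
  have h2 : Measurable fun p : ℝ × (Fin n → ℝ) => p.2 k :=
    (measurable_pi_apply k).comp measurable_snd
  exact hg.comp (h1.prodMk h2)

lemma measurable_chainProd_right {n : ℕ} {g : ℝ → ℝ → ℝ≥0∞}
    (hg : Measurable (Function.uncurry g)) (a : ℝ) :
    Measurable fun y : Fin n → ℝ => chainProd g a y :=
  (measurable_chainProd hg).comp (measurable_const.prodMk measurable_id)

/-- Iterated integration of a product along a chain. -/
lemma lintegral_chainProd_le {μ : Measure ℝ} [SigmaFinite μ] {J : Set ℝ}
    (hJ : ∀ᵐ t ∂μ, t ∈ J) {g : ℝ → ℝ → ℝ≥0∞} (hg : Measurable (Function.uncurry g)) {B : ℝ≥0∞}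
    (hB : ∀ a ∈ J, ∫⁻ t, g a t ∂μ ≤ B) (n : ℕ) {a : ℝ} (ha : a ∈ J) :
    ∫⁻ y : Fin n → ℝ, chainProd g a y ∂(Measure.pi fun _ => μ) ≤ B ^ n := by
  induction n generalizing a with
  | zero => simp [chainProd]
  | succ n ih =>
    rw [lintegral_finCons _ (measurable_chainProd_right hg a)]
    simp only [chainProd_succ]
    have hga : Measurable (g a) := hg.comp (measurable_const.prodMk measurable_id)
    have hgp : Measurable fun p : ℝ × (Fin n → ℝ) => g a p.1 * chainProd g p.1 p.2 :=
      (hga.comp measurable_fst).mul (measurable_chainProd hg)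
    rw [lintegral_prod _ hgp.aemeasurable]
    calc _ ≤ ∫⁻ t, g a t * B ^ n ∂μ := by
          refine lintegral_mono_ae ?_
          filter_upwards [hJ] with t ht
          rw [lintegral_const_mul _ (measurable_chainProd_right hg t)]
          gcongr
          exact ih ht
      _ = (∫⁻ t, g a t ∂μ) * B ^ n := lintegral_mul_const _ hga
      _ ≤ B * B ^ n := by gcongr; exact hB a ha
      _ = B ^ (n + 1) := by ring

lemma measurable_abs_sub_rpow (p : ℝ) :
    Measurable (Function.uncurry fun a t : ℝ => ENNReal.ofReal |t - a| ^ (-p)) := by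
  unfold Function.uncurry
  fun_prop

/-- The sum over all orderings `σ` of the inverse powers of consecutive distances of `a` and the
points `y (σ 0), y (σ 1), …`. -/
noncomputable def gapSum {n : ℕ} (p a : ℝ) (y : Fin n → ℝ) : ℝ≥0∞ :=
  ∑ σ : Equiv.Perm (Fin n),
    chainProd (fun a t => ENNReal.ofReal |t - a| ^ (-p)) a fun k => y (σ k)

lemma measurable_gapSum {n : ℕ} (p a : ℝ) : Measurable (gapSum (n := n) p a) := by
  refine Finset.measurable_sum _ fun σ _ => ?_
  have h1 : Measurable fun (y : Fin n → ℝ) k => y (σ k) := by fun_prop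
  exact (measurable_chainProd_right (measurable_abs_sub_rpow p) a).comp h1

lemma lintegral_gapSum_le {p : ℝ} (hp1 : p < 1) {δ : ℝ} (hδ : 0 < δ) (a : ℝ) (n : ℕ) :
    ∫⁻ y : Fin n → ℝ, gapSum p a y
        ∂(Measure.pi fun _ => volume.restrict (Set.Icc a (a + δ)))
      ≤ n.factorial * ENNReal.ofReal (2 * (δ ^ (1 - p) / (1 - p))) ^ n := by
  set μ : Measure ℝ := volume.restrict (Set.Icc a (a + δ)) with hμ
  have hmeas := measurable_chainProd_right (n := n) (measurable_abs_sub_rpow p) a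
  have hperm : ∀ σ : Equiv.Perm (Fin n),
      MeasurePreserving (fun (y : Fin n → ℝ) k => y (σ k)) (Measure.pi fun _ => μ)
        (Measure.pi fun _ => μ) := by
    intro σ
    convert! measurePreserving_piCongrLeft (fun _ : Fin n => μ) σ.symm using 1
    ext y k
    rw [MeasurableEquiv.coe_piCongrLeft]
    have := Equiv.piCongrLeft_apply_apply (fun _ : Fin n => ℝ) σ.symm y (σ k)
    rw [Equiv.symm_apply_apply] at this
    exact this.symm
  have hmeas' : ∀ σ : Equiv.Perm (Fin n), Measurable fun y : Fin n → ℝ =>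
      chainProd (fun a t => ENNReal.ofReal |t - a| ^ (-p)) a fun k => y (σ k) :=
    fun σ => hmeas.comp (hperm σ).measurable
  unfold gapSum
  rw [lintegral_finsetSum _ fun σ _ => hmeas' σ]
  refine (Finset.sum_le_card_nsmul _ _
    (ENNReal.ofReal (2 * (δ ^ (1 - p) / (1 - p))) ^ n) fun σ _ => ?_).trans (le_of_eq ?_)
  · rw [(hperm σ).lintegral_comp hmeas]
    exact lintegral_chainProd_le (ae_restrict_mem measurableSet_Icc) (measurable_abs_sub_rpow p)
      (fun a' ha' => lintegral_Icc_abs_sub_rpow_le hp1 hδ ha') n ⟨le_rfl, by linarith⟩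
  · rw [Finset.card_univ, Fintype.card_perm, Fintype.card_fin, nsmul_eq_mul]

lemma ennreal_rpow_sum {ι : Type*} (s : Finset ι) {r : ι → ℝ} (hr : ∀ i, 0 ≤ r i) (x : ℝ≥0∞) :
    x ^ (∑ i ∈ s, r i) = ∏ i ∈ s, x ^ r i := by
  classical
  induction s using Finset.induction_on with
  | empty => simp
  | insert i s hi ih =>
    rw [Finset.sum_insert hi, Finset.prod_insert hi,
      ENNReal.rpow_add_of_nonneg _ _ (hr i) (Finset.sum_nonneg fun j _ => hr j), ih]

/-- Along the increasing ordering of the points, the product of inverse powers of the gaps is one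
of the summands of `gapSum`. -/
lemma prod_gap_rpow_le {n : ℕ} {D r p a δ : ℝ} {y : Fin n → ℝ} {η : Fin n → ℝ} (hr : 0 ≤ r)
    (hδ1 : δ ≤ 1) (hy : ∀ j, y j ∈ Set.Icc a (a + δ)) (hη : ∀ j, η j * r ≤ p)
    {σ : Equiv.Perm (Fin n)} (hσ : Monotone fun k => y (σ k)) :
    (∏ k, (ENNReal.ofReal D * ENNReal.ofReal
        (y (σ k) - (Fin.cons a fun k => y (σ k) : Fin (n + 1) → ℝ) k.castSucc) ^ (-η (σ k)))) ^ r
      ≤ (ENNReal.ofReal D ^ r) ^ n * gapSum p a y := by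
  have hgap : ∀ k, (Fin.cons a fun k => y (σ k) : Fin (n + 1) → ℝ) k.castSucc ≤ y (σ k) ∧
      a ≤ (Fin.cons a fun k => y (σ k) : Fin (n + 1) → ℝ) k.castSucc := by
    intro k
    cases n with
    | zero => exact k.elim0
    | succ n =>
      refine Fin.cases ?_ (fun i => ?_) k
      · simpa using (hy _).1
      · rw [← Fin.succ_castSucc, Fin.cons_succ]
        exact ⟨hσ i.castSucc_lt_succ.le, (hy _).1⟩
  have hle : ∏ k, ENNReal.ofReal
      |y (σ k) - (Fin.cons a fun k => y (σ k) : Fin (n + 1) → ℝ) k.castSucc| ^ (-p)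
        ≤ gapSum p a y :=
    Finset.single_le_sum (f := fun σ : Equiv.Perm (Fin n) =>
      chainProd (fun a t => ENNReal.ofReal |t - a| ^ (-p)) a fun k => y (σ k))
      (fun _ _ => zero_le) (Finset.mem_univ σ)
  refine le_trans ?_ (mul_le_mul_right hle _)
  rw [← ENNReal.prod_rpow_of_nonneg hr]
  calc _ ≤ ∏ k : Fin n, (ENNReal.ofReal D ^ r * ENNReal.ofReal
      |y (σ k) - (Fin.cons a fun k => y (σ k) : Fin (n + 1) → ℝ) k.castSucc| ^ (-p)) := by
        refine Finset.prod_le_prod' fun k _ => ?_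
        rw [ENNReal.mul_rpow_of_nonneg _ _ hr, ← ENNReal.rpow_mul,
          abs_of_nonneg (sub_nonneg.2 (hgap k).1)]
        refine mul_le_mul_right (ENNReal.rpow_le_rpow_of_exponent_ge ?_ ?_) _
        · rw [ENNReal.ofReal_le_one]
          linarith [(hy (σ k)).2, (hgap k).2]
        · linarith [hη (σ k)]
    _ = _ := by rw [Finset.prod_mul_distrib, Finset.prod_const, Finset.card_univ, Fintype.card_fin]

lemma measurableSet_forall_mem {E : Type*} [MeasurableSpace E] {n : ℕ} {C : Set E}
    (hC : MeasurableSet C) : MeasurableSet {U : Fin n → E | ∀ j, U j ∈ C} := by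
  rw [Set.ofPred_forall]
  exact MeasurableSet.iInter fun j => hC.preimage (measurable_pi_apply j)

lemma lintegral_prod_gapSum_le {p : ℝ} (hp1 : p < 1) {δ : ℝ} (hδ : 0 < δ) {N : ℕ}
    (a : Fin N → ℝ) (n : ℕ) :
    ∫⁻ U : Fin n → Fin N → ℝ in {U | ∀ j, U j ∈ Set.Icc a (fun l => a l + δ)},
        ∏ l, gapSum p (a l) (fun j => U j l)
      ≤ (n.factorial * ENNReal.ofReal (2 * (δ ^ (1 - p) / (1 - p))) ^ n) ^ N := by
  have hpre : (fun (V : Fin N → Fin n → ℝ) (j : Fin n) (l : Fin N) => V l j) ⁻¹'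
      {U | ∀ j, U j ∈ Set.Icc a (fun l => a l + δ)}
      = Set.univ.pi fun l => Set.univ.pi fun _ => Set.Icc (a l) (a l + δ) := by
    ext V
    simp only [Set.mem_preimage, Set.mem_ofPred_eq, Set.mem_univ_pi, Set.mem_Icc, Pi.le_def,
      ← forall_and]
    exact forall_comm
  have hmeas : Measurable fun U : Fin n → Fin N → ℝ => ∏ l, gapSum p (a l) fun j => U j l := by
    refine Finset.measurable_prod _ fun l _ => ?_
    have : Measurable fun (U : Fin n → Fin N → ℝ) j => U j l := by fun_prop
    exact (measurable_gapSum p (a l)).comp this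
  rw [← (measurePreserving_swap_matrix n N).setLIntegral_comp_preimage
    (measurableSet_forall_mem measurableSet_Icc) hmeas, hpre, volume_pi,
    Measure.restrict_pi_pi]
  simp only [volume_pi, Measure.restrict_pi_pi]
  rw [lintegral_prod_pi _ fun l => measurable_gapSum p (a l)]
  refine (Finset.prod_le_prod' fun l _ => lintegral_gapSum_le hp1 hδ (a l) n).trans (le_of_eq ?_)
  rw [Finset.prod_const, Finset.card_univ, Fintype.card_fin]

lemma rpow_neg_mul_rpow_le {A m δ : ℝ} (hA : 0 ≤ A) (hm : 0 < m) (hδ : 0 < δ) :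
    δ ^ (-(A * δ ^ m)) ≤ Real.exp (A / m) := by
  rw [Real.rpow_def_of_pos hδ, Real.exp_le_exp]
  have h1 : -Real.log δ ≤ (δ ^ m)⁻¹ / m := by
    have := Real.log_le_rpow_div (inv_pos.2 hδ).le hm
    rwa [Real.log_inv, Real.inv_rpow hδ.le] at this
  have h2 : 0 < δ ^ m := by positivity
  calc Real.log δ * -(A * δ ^ m) = -Real.log δ * (A * δ ^ m) := by ring
    _ ≤ (δ ^ m)⁻¹ / m * (A * δ ^ m) := by gcongr
    _ = A / m := by field_simp

lemma continuousOn_of_abs_sub_le {N : ℕ} {h : (Fin N → ℝ) → ℝ} {m M : Fin N → ℝ}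
    (hm : ∀ l, 0 < m l) {K : Set (Fin N → ℝ)} {c : ℝ} (hc : 0 < c)
    (hh : ∀ u ∈ K, ∀ v ∈ K,
      |h u - h v| ≤ c * ∑ l', min (|u l' - v l'| ^ m l') (|u l' - v l'| ^ M l')) :
    ContinuousOn h K := by
  intro v hv
  have hcont : Continuous fun u : Fin N → ℝ => c * ∑ l, |u l - v l| ^ m l :=
    continuous_const.mul (continuous_finsetSum _ fun l _ =>
      (Real.continuous_rpow_const (hm l).le).comp
        (((continuous_apply l).sub continuous_const).abs))
  have h0 : c * ∑ l, |v l - v l| ^ m l = 0 := by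
    simp [Real.zero_rpow (hm _).ne']
  have hlim := (hcont.tendsto v).mono_left (nhdsWithin_le_nhds (s := K))
  rw [h0] at hlim
  refine tendsto_iff_dist_tendsto_zero.2 (squeeze_zero' (.of_forall fun _ => dist_nonneg) ?_ hlim)
  filter_upwards [self_mem_nhdsWithin] with u hu
  rw [Real.dist_eq]
  refine (hh u hu v hv).trans ?_
  gcongr
  exact min_le_left _ _

/-- Pointwise bound of the `d`-th power of the inner integral, obtained by distributing the `d`
factors over the coordinate directions according to the weights `θ`. -/
lemma exists_lintegral_exp_neg_kernelG_pow_le {N d : ℕ} {α : ℝ} (hα0 : 0 < α) (hα2 : α ≤ 2)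
    {h : Fin N → (Fin N → ℝ) → ℝ} (hH0 : ∀ l u, 0 < h l u) (hH1 : ∀ l u, h l u < 1)
    {ε T : ℝ} (hε : 0 < ε) (hεT : ε < T) :
    ∃ D : ℝ, 1 ≤ D ∧ ∀ (n : ℕ) (U : Fin n → Fin N → ℝ) (a : Fin N → ℝ) (δ p : ℝ) (θ : Fin N → ℝ),
      Set.Icc a (fun l => a l + δ) ⊆ Set.Icc (fun _ : Fin N => ε) (fun _ => T) → 0 < δ → δ ≤ 1 →
      (∀ j, U j ∈ Set.Icc a (fun l => a l + δ)) →
      (∀ l, 0 ≤ θ l) → ∑ l, θ l = 1 → (∀ j l, h l (U j) * (θ l * d) ≤ p) →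
      (∫⁻ x : Fin n → ℝ, ENNReal.ofReal
        (Real.exp (-(∫ w : Fin N → ℝ, |∑ j, x j * kernelG N α h (U j) w| ^ α)))) ^ d
        ≤ (ENNReal.ofReal D ^ (d * n)) ^ N * ∏ l, gapSum p (a l) fun j => U j l := by
  obtain ⟨K, hK0, hK⟩ := exists_lintegral_exp_neg_le hα0
  set C : ℝ := K * ((1 / 4) * (min (ε / 2) T⁻¹ * (ε / 2)) ^ (N - 1)) ^ (-1 / α) with hC
  refine ⟨max 1 C, le_max_left _ _, fun n U a δ p θ hsub hδ hδ1 hU hθ hθ1 hp => ?_⟩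
  have haI : a ∈ Set.Icc (fun _ : Fin N => ε) (fun _ => T) :=
    hsub ⟨le_rfl, fun l => by simp only; linarith⟩
  set J := ∫⁻ x : Fin n → ℝ, ENNReal.ofReal
    (Real.exp (-(∫ w : Fin N → ℝ, |∑ j, x j * kernelG N α h (U j) w| ^ α)))
  have hpow : J ^ d = ∏ l, J ^ (θ l * d) := by
    rw [← ennreal_rpow_sum _ fun l => mul_nonneg (hθ l) d.cast_nonneg, ← Finset.sum_mul, hθ1,
      one_mul, ENNReal.rpow_natCast]
  have hD1 : 1 ≤ ENNReal.ofReal (max 1 C) := by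
    rw [← ENNReal.ofReal_one]
    exact ENNReal.ofReal_le_ofReal (le_max_left _ _)
  have hdir : ∀ l, J ^ (θ l * d) ≤
      ENNReal.ofReal (max 1 C) ^ (d * n) * gapSum p (a l) fun j => U j l := by
    intro l
    have hr : 0 ≤ θ l * d := mul_nonneg (hθ l) d.cast_nonneg
    have hθl : θ l ≤ 1 := hθ1 ▸ Finset.single_le_sum (fun i _ => hθ i) (Finset.mem_univ l)
    have hσ := Tuple.monotone_sort fun j => U j l
    refine (ENNReal.rpow_le_rpow (lintegral_exp_neg_kernelG_le hα0 hα2 hK0 hK hH0 hH1 hε hεT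
      (fun j l => (hsub (hU j)).1 l) (fun j l => (hsub (hU j)).2 l) l (haI.1 l)
      (fun j => (hU j).1 l) _ hσ) hr).trans ?_
    refine (prod_gap_rpow_le (y := fun j => U j l) (η := fun j => h l (U j)) hr hδ1
      (fun j => ⟨(hU j).1 l, (hU j).2 l⟩) (fun j => hp j l) hσ).trans ?_
    rw [← hC, pow_mul]
    refine mul_le_mul_left (pow_le_pow_left' ?_ n) _
    calc ENNReal.ofReal C ^ (θ l * d) ≤ ENNReal.ofReal (max 1 C) ^ (θ l * d) :=
          ENNReal.rpow_le_rpow (ENNReal.ofReal_le_ofReal (le_max_right _ _)) hr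
      _ ≤ ENNReal.ofReal (max 1 C) ^ (d : ℝ) :=
          ENNReal.rpow_le_rpow_of_exponent_le hD1
            (mul_le_of_le_one_left d.cast_nonneg hθl)
      _ = ENNReal.ofReal (max 1 C) ^ d := ENNReal.rpow_natCast _ _
  rw [hpow]
  refine (Finset.prod_le_prod' fun l _ => hdir l).trans (le_of_eq ?_)
  rw [Finset.prod_mul_distrib, Finset.prod_const, Finset.card_univ, Fintype.card_fin]

lemma exists_Mn_le {N d : ℕ} {α : ℝ} (hα0 : 0 < α) (hα2 : α ≤ 2)
    {h : Fin N → (Fin N → ℝ) → ℝ} (hH0 : ∀ l u, 0 < h l u) (hH1 : ∀ l u, h l u < 1)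
    {ε T : ℝ} (hε : 0 < ε) (hεT : ε < T) :
    ∃ D : ℝ, 1 ≤ D ∧ ∀ (n : ℕ) (a : Fin N → ℝ) (δ p : ℝ) (θ : Fin N → ℝ),
      Set.Icc a (fun l => a l + δ) ⊆ Set.Icc (fun _ : Fin N => ε) (fun _ => T) → 0 < δ → δ ≤ 1 →
      p < 1 → (∀ l, 0 ≤ θ l) → ∑ l, θ l = 1 →
      (∀ u ∈ Set.Icc a (fun l => a l + δ), ∀ l, h l u * (θ l * d) ≤ p) →
      Mn N d α h n (Set.Icc a (fun l => a l + δ)) ≤ ENNReal.ofReal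
        ((D ^ (d * n) * (n.factorial * (2 * (δ ^ (1 - p) / (1 - p))) ^ n)) ^ N) := by
  obtain ⟨D, hD1, hD⟩ := exists_lintegral_exp_neg_kernelG_pow_le (d := d) hα0 hα2 hH0 hH1 hε hεT
  refine ⟨D, hD1, fun n a δ p θ hsub hδ hδ1 hp1 hθ hθ1 hp => ?_⟩
  have hD0 : 0 ≤ D := by linarith
  have hp0 : 0 < 1 - p := by linarith
  have hpi : ENNReal.ofReal ((2 * Real.pi) ^ (-((n : ℝ) * d))) ≤ 1 := by
    rw [ENNReal.ofReal_le_one]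
    exact Real.rpow_le_one_of_one_le_of_nonpos (by linarith [Real.pi_gt_three])
      (neg_nonpos.2 (by positivity))
  unfold Mn
  refine (mul_le_of_le_one_left' hpi).trans ?_
  calc _ ≤ ∫⁻ U : Fin n → Fin N → ℝ in {U | ∀ j, U j ∈ Set.Icc a (fun l => a l + δ)},
        (ENNReal.ofReal D ^ (d * n)) ^ N * ∏ l, gapSum p (a l) (fun j => U j l) :=
        setLIntegral_mono' (measurableSet_forall_mem measurableSet_Icc) fun U hU =>
          hD n U a δ p θ hsub hδ hδ1 hU hθ hθ1 fun j l => hp (U j) (hU j) l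
    _ = (ENNReal.ofReal D ^ (d * n)) ^ N *
        ∫⁻ U : Fin n → Fin N → ℝ in {U | ∀ j, U j ∈ Set.Icc a (fun l => a l + δ)},
          ∏ l, gapSum p (a l) (fun j => U j l) :=
        lintegral_const_mul' _ _ (by simp)
    _ ≤ (ENNReal.ofReal D ^ (d * n)) ^ N *
        (n.factorial * ENNReal.ofReal (2 * (δ ^ (1 - p) / (1 - p))) ^ n) ^ N := by
        gcongr
        exact lintegral_prod_gapSum_le hp1 hδ a n
    _ = _ := by
        rw [← mul_pow, ENNReal.ofReal_pow (by positivity),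
          ENNReal.ofReal_mul (p := D ^ (d * n)) (by positivity),
          ENNReal.ofReal_mul (p := (n.factorial : ℝ)) (by positivity), ENNReal.ofReal_pow hD0,
          ENNReal.ofReal_pow (by positivity), ENNReal.ofReal_natCast]

lemma exists_lt_forall_le_sum_inv {N d : ℕ} {h : Fin N → (Fin N → ℝ) → ℝ} (hH0 : ∀ l u, 0 < h l u)
    {I : Set (Fin N → ℝ)} (hI : IsCompact I) (hne : I.Nonempty) (hcont : ∀ l, ContinuousOn (h l) I)
    (hd : ∀ v ∈ I, (d : ℝ) < ∑ l, 1 / h l v) :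
    ∃ s : ℝ, (d : ℝ) < s ∧ ∀ v ∈ I, s ≤ ∑ l, 1 / h l v := by
  have hc : ContinuousOn (fun v => ∑ l, 1 / h l v) I :=
    continuousOn_finsetSum _ fun l _ => continuousOn_const.div (hcont l) fun v _ => (hH0 l v).ne'
  obtain ⟨v, hv, hmin⟩ := hI.exists_isMinOn hne hc
  exact ⟨_, hd v hv, fun u hu => hmin hu⟩

/-- Remark 3.3: the simpler moment estimate
`M_n(I_{a,δ}) ≤ c(n) (n!)^{Nν} δ^{Nn(1-ν)}` with `ν = d / ∑_l 1/h_l(u*)`. -/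
theorem moment_bound_local_time_simple (N : ℕ) (hN : 1 ≤ N) (d : ℕ) (hd : 1 ≤ d)
    (α : ℝ) (hα0 : 0 < α) (hα2 : α ≤ 2)
    (h : Fin N → (Fin N → ℝ) → ℝ) (m M : Fin N → ℝ)
    (hm : ∀ l, 0 < m l) (hmM : ∀ l, m l ≤ M l) (hM1 : ∀ l, M l < 1)
    (hH1 : ∀ l u, m l ≤ h l u ∧ h l u ≤ M l)
    (hH2 : ∀ K : Set (Fin N → ℝ), IsCompact K → ∃ c > 0, ∀ u ∈ K, ∀ v ∈ K, ∀ l,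
      |h l u - h l v| ≤ c * ∑ l', min (|u l' - v l'| ^ m l') (|u l' - v l'| ^ M l'))
    (ε T : ℝ) (hε : 0 < ε) (hεT : ε < T)
    (hC1 : ∀ v ∈ Set.Icc (fun _ : Fin N => ε) (fun _ => T), (d : ℝ) < ∑ l, 1 / h l v) :
    ∀ n : ℕ, 1 ≤ n → ∃ c > (0 : ℝ), ∃ δ₀ : ℝ, 0 < δ₀ ∧ δ₀ ≤ 1 ∧
      ∀ (a : Fin N → ℝ) (δ : ℝ), 0 < δ → δ ≤ δ₀ →
        Set.Icc a (fun l => a l + δ) ⊆ Set.Icc (fun _ : Fin N => ε) (fun _ => T) →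
        ∀ ustar ∈ Set.Icc a (fun l => a l + δ),
          Mn N d α h n (Set.Icc a (fun l => a l + δ)) ≤
            ENNReal.ofReal (c *
              (n.factorial : ℝ) ^ ((N : ℝ) * ((d : ℝ) / ∑ l, 1 / h l ustar)) *
              δ ^ ((N : ℝ) * n * (1 - (d : ℝ) / ∑ l, 1 / h l ustar))) := by
  intro n _
  have hH0 : ∀ l u, 0 < h l u := fun l u => (hm l).trans_le (hH1 l u).1
  have hHlt : ∀ l u, h l u < 1 := fun l u => (hH1 l u).2.trans_lt (hM1 l)
  have hd0 : (0 : ℝ) < d := by exact_mod_cast hd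
  obtain ⟨c₁, hc₁, hlip⟩ := hH2 (Set.Icc (fun _ : Fin N => ε) (fun _ => T)) isCompact_Icc
  obtain ⟨s, hds, hs⟩ := exists_lt_forall_le_sum_inv hH0 isCompact_Icc
    ⟨fun _ => ε, le_rfl, fun _ => hεT.le⟩
    (fun l => continuousOn_of_abs_sub_le hm hc₁ fun u hu v hv => hlip u hu v hv l) hC1
  obtain ⟨D, hD1, hD⟩ := exists_Mn_le (d := d) hα0 hα2 hH0 hHlt hε hεT
  obtain ⟨m₀, hm₀, hm₀m⟩ : ∃ m₀ > 0, ∀ l, m₀ ≤ m l := by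
    obtain ⟨l, -, hl⟩ := Finset.exists_min_image Finset.univ m ⟨⟨0, hN⟩, Finset.mem_univ _⟩
    exact ⟨m l, hm l, fun l' => hl l' (Finset.mem_univ _)⟩
  have hN0 : (0 : ℝ) < N := by exact_mod_cast hN
  have hs0 : 0 < s := hd0.trans hds
  set A : ℝ := d * (c₁ * N) with hA
  have hA0 : 0 < A := by positivity
  set g : ℝ := 1 - d / s with hg
  have hg0 : 0 < g := sub_pos.2 ((div_lt_one hs0).2 hds)
  refine ⟨(D ^ (d * n) * (n.factorial * (2 * (2 / g) * Real.exp (A / m₀)) ^ n)) ^ N,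
    by positivity, min 1 ((g / 2 / A) ^ (1 / m₀)), by positivity, min_le_left _ _, ?_⟩
  intro a δ hδ hδ₀ hsub u hu
  have hδ1 : δ ≤ 1 := hδ₀.trans (min_le_left _ _)
  set S : ℝ := ∑ l, 1 / h l u with hS
  have hsS : s ≤ S := hs u (hsub hu)
  have hS0 : 0 < S := hs0.trans_le hsS
  set ν : ℝ := d / S with hν
  have hν0 : 0 < ν := by positivity
  have hνg : g ≤ 1 - ν := by
    have : (d : ℝ) / S ≤ d / s := by gcongr
    linarith
  have hAδ : A * δ ^ m₀ ≤ g / 2 := by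
    have h1 : δ ^ m₀ ≤ g / 2 / A := by
      calc δ ^ m₀ ≤ ((g / 2 / A) ^ (1 / m₀)) ^ m₀ :=
            Real.rpow_le_rpow hδ.le (hδ₀.trans (min_le_right _ _)) hm₀.le
        _ = g / 2 / A := by
            rw [← Real.rpow_mul (by positivity), one_div_mul_cancel hm₀.ne', Real.rpow_one]
    rw [le_div_iff₀ hA0] at h1
    linarith
  set p : ℝ := ν + A * δ ^ m₀ with hp
  have hp1 : g / 2 ≤ 1 - p := by linarith
  have hosc : ∀ v ∈ Set.Icc a (fun l => a l + δ), ∀ l, h l v ≤ h l u + c₁ * (N * δ ^ m₀) := by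
    intro v hv l
    have h1 := (le_abs_self _).trans (hlip v (hsub hv) u (hsub hu) l)
    have h2 : ∑ l', min (|v l' - u l'| ^ m l') (|v l' - u l'| ^ M l') ≤ N * δ ^ m₀ := by
      refine (Finset.sum_le_card_nsmul _ _ (δ ^ m₀) fun l' _ => ?_).trans (by simp)
      have h3 : |v l' - u l'| ≤ δ := by
        have := hv.1 l'
        have := hv.2 l'
        have := hu.1 l'
        have := hu.2 l'
        simp only at *
        rw [abs_le]
        constructor <;> linarith
      calc _ ≤ |v l' - u l'| ^ m l' := min_le_left _ _
        _ ≤ δ ^ m l' := Real.rpow_le_rpow (abs_nonneg _) h3 (hm l').le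
        _ ≤ δ ^ m₀ := Real.rpow_le_rpow_of_exponent_ge hδ hδ1 (hm₀m l')
    have := mul_le_mul_of_nonneg_left h2 hc₁.le
    linarith
  have hθ0 : ∀ l, 0 ≤ 1 / h l u / S := fun l => by have := hH0 l u; positivity
  have hθ1 : ∑ l, 1 / h l u / S = 1 := by rw [← Finset.sum_div, ← hS, div_self hS0.ne']
  refine (hD n a δ p (fun l => 1 / h l u / S) hsub hδ hδ1 (by linarith) hθ0 hθ1 ?_).trans ?_
  · intro v hv l
    have hθl : 1 / h l u / S ≤ 1 :=
      (Finset.single_le_sum (fun i _ => hθ0 i) (Finset.mem_univ l)).trans_eq hθ1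
    calc h l v * (1 / h l u / S * d) ≤ (h l u + c₁ * (N * δ ^ m₀)) * (1 / h l u / S * d) :=
          mul_le_mul_of_nonneg_right (hosc v hv l) (mul_nonneg (hθ0 l) hd0.le)
      _ = ν + A * δ ^ m₀ * (1 / h l u / S) := by
          have := (hH0 l u).ne'
          rw [hν, hA]
          field_simp
      _ ≤ ν + A * δ ^ m₀ := by
          have := mul_le_of_le_one_right (show 0 ≤ A * δ ^ m₀ by positivity) hθl
          linarith
  refine ENNReal.ofReal_le_ofReal ?_
  have hfac : 1 ≤ (n.factorial : ℝ) ^ ((N : ℝ) * ν) :=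
    Real.one_le_rpow (by exact_mod_cast n.factorial_pos) (by positivity)
  have hδp : δ ^ (1 - p) / (1 - p) ≤ δ ^ (1 - ν) * Real.exp (A / m₀) * (2 / g) := by
    have hp0 : 0 < 1 - p := by linarith
    rw [div_eq_mul_inv]
    refine mul_le_mul ?_ ?_ (by positivity) (by positivity)
    · rw [show 1 - p = 1 - ν + -(A * δ ^ m₀) by rw [hp]; ring, Real.rpow_add hδ]
      gcongr
      exact rpow_neg_mul_rpow_le hA0.le hm₀ hδ
    · rw [← inv_div]
      gcongr
  have hp0 : 0 < 1 - p := by linarith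
  calc _ ≤ (D ^ (d * n) * (n.factorial *
        (2 * (δ ^ (1 - ν) * Real.exp (A / m₀) * (2 / g))) ^ n)) ^ N := by gcongr
    _ = (D ^ (d * n) * (n.factorial * (2 * (2 / g) * Real.exp (A / m₀)) ^ n)) ^ N * 1 *
        δ ^ ((N : ℝ) * n * (1 - ν)) := by
        rw [show (N : ℝ) * n * (1 - ν) = (1 - ν) * n * N by ring, Real.rpow_mul hδ.le,
          Real.rpow_natCast, Real.rpow_mul hδ.le, Real.rpow_natCast]
        rw [mul_one, ← mul_pow, show 2 * (δ ^ (1 - ν) * Real.exp (A / m₀) * (2 / g)) =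
          2 * (2 / g) * Real.exp (A / m₀) * δ ^ (1 - ν) by ring, mul_pow _ (δ ^ (1 - ν)) n]
        congr 1
        ring
    _ ≤ _ := by gcongr
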